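/- arXiv:1703.01686 — 5 statements merged into one kernel-verified Lean document; each statement's English description precedes it below -/
import Mathlib

section
/- In the graph G_φ (defined in the context), the reload cost function satisfies the triangle inequality: for every three distinct edges e₁, e₂, e₃ of G_φ incident to a common vertex, c(e₁, e₃) ≤ c(e₁, e₂) + c(e₂, e₃). -/
/-- The reload cost of a sequence of colors: sum of `c` over consecutive pairs. -/
def chainCost {X : Type*} (c : X → X → ℕ) : List X → ℕ
  | a :: b :: l => c a b + chainCost c (b :: l)
  | _ => 0

/-- The reload cost of a walk `p` in a graph with edge-coloring `χ` and reload cost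
function `c` on colors. -/
def walkCost {V X : Type*} {G : SimpleGraph V} (χ : Sym2 V → X) (c : X → X → ℕ)
    {u v : V} (p : G.Walk u v) : ℕ :=
  chainCost c (p.edges.map χ)

/-- Vertices of the graph `G_φ`: `none` is the distinguished vertex `r`, and
`some (j, i)` is the vertex `v^j_i` of the clause gadget of clause `j`. -/
abbrev Vphi (m : ℕ) := Option (Fin m × Fin 3)

/-- The edges of `G_φ`: `r` is joined to all `v^j_i`, and in each clause gadget there
are the edges `{v^j_1, v^j_2}` and `{v^j_2, v^j_3}`. -/
def GphiRel (m : ℕ) : Vphi m → Vphi m → Prop := fun a b =>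
  (a = none ∧ b ≠ none) ∨
  (∃ (j : Fin m) (i i' : Fin 3), a = some (j, i) ∧ b = some (j, i') ∧
    (i.val + 1 = i'.val ∨ i'.val + 1 = i.val))

def Gphi (m : ℕ) : SimpleGraph (Vphi m) := SimpleGraph.fromRel (GphiRel m)

open scoped Classical in
/-- The reload cost function of `G_φ`. Each edge has its own distinct color, so colors
are identified with (potential) edges, i.e., elements of `Sym2 (Vphi m)`.
Cost 10 between two spokes `{r, v^{j₁}_{i₁}}, {r, v^{j₂}_{i₂}}` carrying a literal and
its negation, 5 between two spokes otherwise, and 1 for any other pair. -/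
noncomputable def phiCost {V : Type*} (m : ℕ) (lit : Fin m → Fin 3 → V × Bool)
    (e₁ e₂ : Sym2 (Vphi m)) : ℕ :=
  if h₁ : ∃ p : Fin m × Fin 3, e₁ = s((none : Vphi m), some p) then
    if h₂ : ∃ q : Fin m × Fin 3, e₂ = s((none : Vphi m), some q) then
      if (lit h₁.choose.1 h₁.choose.2).1 = (lit h₂.choose.1 h₂.choose.2).1 ∧
          (lit h₁.choose.1 h₁.choose.2).2 ≠ (lit h₂.choose.1 h₂.choose.2).2
      then 10 else 5
    else 1
  else 1


/-- In the graph `G_φ` built from a 3-CNF formula in which no clause contains a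
literal and its negation, the reload cost function satisfies the triangle inequality:
for every three distinct edges of `G_φ` incident to a common vertex `x`,
`c(e₁, e₃) ≤ c(e₁, e₂) + c(e₂, e₃)`. -/
theorem stmt1 {V : Type*} (m : ℕ) (lit : Fin m → Fin 3 → V × Bool)
    (hnc : ∀ (j : Fin m) (i i' : Fin 3),
      (lit j i).1 = (lit j i').1 → (lit j i).2 = (lit j i').2) :
    ∀ (x : Vphi m) (e₁ e₂ e₃ : Sym2 (Vphi m)),
      e₁ ∈ (Gphi m).edgeSet → e₂ ∈ (Gphi m).edgeSet → e₃ ∈ (Gphi m).edgeSet →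
      e₁ ≠ e₂ → e₂ ≠ e₃ → e₁ ≠ e₃ →
      x ∈ e₁ → x ∈ e₂ → x ∈ e₃ →
      phiCost m lit e₁ e₃ ≤ phiCost m lit e₁ e₂ + phiCost m lit e₂ e₃ := by
  intro x e₁ e₂ e₃ _ g2 _ _ _ h13 x1 x2 x3
  by_cases h₁ : ∃ p : Fin m × Fin 3, e₁ = s((none : Vphi m), some p)
  · by_cases h₃ : ∃ p : Fin m × Fin 3, e₃ = s((none : Vphi m), some p)
    · have hx : x = none := by
        obtain ⟨p, rfl⟩ := h₁
        obtain ⟨q, rfl⟩ := h₃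
        rw [Sym2.mem_iff] at x1 x3
        rcases x1 with h | h
        · exact h
        · rcases x3 with h' | h'
          · exact h'
          · exact absurd (by rw [← h, ← h']) h13
      have h₂ : ∃ p : Fin m × Fin 3, e₂ = s((none : Vphi m), some p) := by
        subst hx
        obtain ⟨y, rfl⟩ := x2
        cases y with
        | none => exact absurd rfl ((SimpleGraph.mem_edgeSet _).1 g2).ne
        | some q => exact ⟨q, rfl⟩
      unfold phiCost
      simp only [dif_pos h₁, dif_pos h₂, dif_pos h₃]
      split_ifs <;> omega
    · unfold phiCost
      simp only [dif_pos h₁, dif_neg h₃]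
      split_ifs <;> omega
  · unfold phiCost
    simp only [dif_neg h₁]
    omega
end

section
/- Let G_φ be the graph with edge-coloring and reload costs defined in the context. For every spanning tree T of G_φ, diam(T) ≤ 4 + M, where M is the maximum of c(e, e') over all pairs of distinct edges e, e' of T incident to r (with M = 0 if r has degree at most 1 in T). -/
theorem aux_cost {V : Type*} (m : ℕ) (lit : Fin m → Fin 3 → V × Bool)
    (e₁ e₂ : Sym2 (Vphi m)) (h : (none : Vphi m) ∉ e₁ ∨ (none : Vphi m) ∉ e₂) :
    phiCost m lit e₁ e₂ ≤ 1 := by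
  unfold phiCost
  split_ifs with h₁ h₂ h₃
  · obtain ⟨p, rfl⟩ := h₁
    obtain ⟨q, rfl⟩ := h₂
    simp at h
  · obtain ⟨p, rfl⟩ := h₁
    obtain ⟨q, rfl⟩ := h₂
    simp at h
  · exact le_rfl
  · exact le_rfl

theorem aux_left {V : Type*} (m : ℕ) (lit : Fin m → Fin 3 → V × Bool)
    (e : Sym2 (Vphi m)) (l₂ : List (Sym2 (Vphi m))) :
    ∀ l : List (Sym2 (Vphi m)), (∀ x ∈ l, (none : Vphi m) ∉ x) →
    chainCost (phiCost m lit) (l ++ e :: l₂) ≤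
      l.length + chainCost (phiCost m lit) (e :: l₂)
  | [], _ => by simp
  | [a], h => by
    have := aux_cost m lit a e (Or.inl (h a (by simp)))
    simp only [List.cons_append, List.nil_append, List.length_singleton]
    rw [chainCost]
    omega
  | a :: b :: l, h => by
    have h1 := aux_cost m lit a b (Or.inl (h a (by simp)))
    have h2 := aux_left m lit e l₂ (b :: l) (fun x hx => h x (List.mem_cons_of_mem _ hx))
    simp only [List.cons_append, List.length_cons] at h2 ⊢
    rw [chainCost]
    omega

theorem aux_right {V : Type*} (m : ℕ) (lit : Fin m → Fin 3 → V × Bool) :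
    ∀ (l : List (Sym2 (Vphi m))) (e : Sym2 (Vphi m)), (∀ x ∈ l, (none : Vphi m) ∉ x) →
    chainCost (phiCost m lit) (e :: l) ≤ l.length
  | [], e, _ => by simp [chainCost]
  | a :: l, e, h => by
    have h1 := aux_cost m lit e a (Or.inr (h a (by simp)))
    have h2 := aux_right m lit l a (fun x hx => h x (List.mem_cons_of_mem _ hx))
    rw [chainCost]
    simp only [List.length_cons]
    omega

theorem aux_supp {m : ℕ} {T : SimpleGraph (Vphi m)} (hsub : T ≤ Gphi m) {u v : Vphi m}
    (q : T.Walk u v) : ∀ (j : Fin m) (i : Fin 3), u = some (j, i) →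
    none ∉ q.support → ∀ w ∈ q.support, ∃ i', w = some (j, i') := by
  induction q with
  | nil =>
    intro j i hu _ w hw
    simp at hw
    exact ⟨i, hw.trans hu⟩
  | @cons a b c h q ih =>
    intro j i hu hn w hw
    rw [SimpleGraph.Walk.support_cons, List.mem_cons] at hn hw
    push Not at hn
    have hb : b ≠ none := fun hb => hn.2 (hb ▸ q.start_mem_support)
    have h' := hsub h
    have : ∃ i', b = some (j, i') := by
      rw [Gphi, SimpleGraph.fromRel_adj] at h'
      subst hu
      rcases h'.2 with (⟨h1, _⟩ | ⟨j', i1, i2, h1, h2, _⟩) | (⟨h1, _⟩ | ⟨j', i1, i2, h1, h2, _⟩)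
      · simp at h1
      · simp at h1
        exact ⟨i2, by rw [h2, h1.1]⟩
      · exact absurd h1 hb
      · simp at h2
        exact ⟨i1, by rw [h1, h2.1]⟩
    obtain ⟨i', hi'⟩ := this
    rcases hw with rfl | hw
    · exact ⟨i, hu⟩
    · exact ih j i' hi' hn.2 w hw

theorem aux_len {m : ℕ} {T : SimpleGraph (Vphi m)} (hsub : T ≤ Gphi m) {u v : Vphi m}
    (q : T.Walk u v) (hq : q.IsPath) (hn : none ∉ q.support) :
    q.edges.length ≤ 2 ∧ ∀ e ∈ q.edges, (none : Vphi m) ∉ e := by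
  constructor
  · rcases u with _ | ⟨j, i⟩
    · exact absurd q.start_mem_support hn
    have hs := aux_supp hsub q j i rfl hn
    have h1 : q.support.toFinset ⊆
        (Finset.univ : Finset (Fin 3)).image (fun i => (some (j, i) : Vphi m)) := by
      intro w hw
      obtain ⟨i', rfl⟩ := hs w (by simpa using hw)
      simp
    have h2 := (Finset.card_le_card h1).trans Finset.card_image_le
    rw [List.toFinset_card_of_nodup hq.support_nodup, SimpleGraph.Walk.length_support] at h2
    simp at h2 ⊢
    omega
  · intro e he hne
    exact hn (SimpleGraph.Walk.mem_support_of_mem_edges he hne)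

/-- Paths from the root: the edges are empty, or a spoke followed by at most two non-spokes. -/
theorem aux_root {m : ℕ} {T : SimpleGraph (Vphi m)} (hsub : T ≤ Gphi m) {v : Vphi m}
    (q : T.Walk none v) (hq : q.IsPath) :
    q.edges = [] ∨ ∃ e l, q.edges = e :: l ∧ none ∈ e ∧ l.length ≤ 2 ∧
      ∀ x ∈ l, (none : Vphi m) ∉ x := by
  cases q with
  | nil => simp
  | cons h q =>
    rw [SimpleGraph.Walk.cons_isPath_iff] at hq
    have := aux_len hsub q hq.1 hq.2
    exact Or.inr ⟨_, _, SimpleGraph.Walk.edges_cons _ _, by simp, this.1, this.2⟩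

/-- For every spanning tree `T` of `G_φ`, the reload diameter of `T` is at most
`4 + M`, where `M` is (an upper bound on, hence in particular the maximum of) the
reload costs `c(e, e')` over all pairs of distinct edges `e, e'` of `T` incident to the
vertex `r` (so `M = 0` works when `r` has degree at most one in `T`). -/
theorem stmt3 {V : Type*} (m : ℕ) (lit : Fin m → Fin 3 → V × Bool)
    (hnc : ∀ (j : Fin m) (i i' : Fin 3),
      (lit j i).1 = (lit j i').1 → (lit j i).2 = (lit j i').2)
    (T : SimpleGraph (Vphi m)) (hsub : T ≤ Gphi m) (hT : T.IsTree) (M : ℕ)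
    (hM : ∀ e e' : Sym2 (Vphi m), e ∈ T.edgeSet → e' ∈ T.edgeSet →
      (none : Vphi m) ∈ e → (none : Vphi m) ∈ e' → e ≠ e' →
      phiCost m lit e e' ≤ M) :
    ∀ (u v : Vphi m) (p : T.Walk u v), p.IsPath →
      walkCost id (phiCost m lit) p ≤ 4 + M := by
  intro u v p hp
  unfold walkCost
  rw [List.map_id]
  by_cases hn : none ∈ p.support
  · have hE : p.edges = (p.takeUntil none hn).reverse.edges.reverse ++
        (p.dropUntil none hn).edges := by
      rw [SimpleGraph.Walk.edges_reverse, List.reverse_reverse,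
        ← SimpleGraph.Walk.edges_append, SimpleGraph.Walk.take_spec]
    have hnd := hp.isTrail.edges_nodup
    have hmem : ∀ e ∈ p.edges, e ∈ T.edgeSet := fun e he => p.edges_subset_edgeSet he
    have hA := aux_root hsub _ (hp.takeUntil hn).reverse
    have hB := aux_root hsub _ (hp.dropUntil hn)
    rw [hE] at hnd hmem ⊢
    rcases hA with hA | ⟨e, l, hA, he, hl, hx⟩ <;>
    rcases hB with hB | ⟨e', l', hB, he', hl', hx'⟩ <;>
    rw [hA, hB] at hnd hmem ⊢
    · simp [chainCost]
    · have := aux_right m lit l' e' hx'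
      simp only [List.reverse_nil, List.nil_append]
      omega
    · have := aux_left m lit e [] l.reverse (by simpa using hx)
      simp only [chainCost, List.length_reverse] at this
      simp only [List.reverse_cons, List.append_nil]
      omega
    · have h1 := aux_left m lit e (e' :: l') l.reverse (by simpa using hx)
      have h2 := aux_right m lit l' e' hx'
      have hne : e ≠ e' := by
        rintro rfl
        simp [List.nodup_append] at hnd
      have h3 := hM e e' (hmem e (by simp)) (hmem e' (by simp)) he he' hne
      rw [chainCost, List.length_reverse] at h1
      simp only [List.reverse_cons, List.append_assoc, List.singleton_append]
      omega
  · have h := aux_len hsub p hp hn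
    cases hl : p.edges with
    | nil => simp [chainCost]
    | cons e l =>
      rw [hl] at h
      have := aux_right m lit l e (fun x hx => h.2 x (List.mem_cons_of_mem _ hx))
      have h1 := h.1
      simp only [List.length_cons] at h1
      omega
end

section
/- Let G be a graph constructed as in the context, with the described edge-coloring and reload costs, from a CNF formula φ in which each variable occurs exactly three times, at least once positively and once negatively. If T is a spanning tree of G with reload diameter diam(T) = 0, then every clause vertex c_j has degree exactly 1 in T. -/
/-- Vertices of the graph `G`: for each variable `i` the five vertices
`u_i, v_i, p_i, r_i, n_i` (encoded as `Sum.inl (i, 0), …, Sum.inl (i, 4)`), and for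
each clause `j` one vertex `c_j` (encoded as `Sum.inr j`). -/
abbrev VG (n m : ℕ) := (Fin n × Fin 5) ⊕ Fin m

def vU {n m : ℕ} (i : Fin n) : VG n m := Sum.inl (i, 0)
def vV {n m : ℕ} (i : Fin n) : VG n m := Sum.inl (i, 1)
def vP {n m : ℕ} (i : Fin n) : VG n m := Sum.inl (i, 2)
def vR {n m : ℕ} (i : Fin n) : VG n m := Sum.inl (i, 3)
def vN {n m : ℕ} (i : Fin n) : VG n m := Sum.inl (i, 4)
def vC {n m : ℕ} (j : Fin m) : VG n m := Sum.inr j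

/-- The edges of `G`, given the function `conn` telling, for each variable `i`, the
clause vertices that `p_i` (slot 0), `r_i` (slot 1), and `n_i` (slot 2) are joined
to: the variable-gadget edges `{u_i, v_i}, {v_i, p_i}, {p_i, r_i}, {r_i, n_i},
{n_i, v_i}`, the path edges `{u_i, u_{i+1}}`, and the occurrence edges between
`p_i, r_i, n_i` and the corresponding clause vertices. -/
def g3Rel (n m : ℕ) (conn : Fin n → Fin 3 → Fin m) : VG n m → VG n m → Prop :=
  fun a b =>
    (∃ i, a = vU i ∧ b = vV i) ∨
    (∃ i, a = vV i ∧ b = vP i) ∨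
    (∃ i, a = vP i ∧ b = vR i) ∨
    (∃ i, a = vR i ∧ b = vN i) ∨
    (∃ i, a = vN i ∧ b = vV i) ∨
    (∃ (i : Fin n) (h : i.val + 1 < n), a = vU i ∧ b = vU ⟨i.val + 1, h⟩) ∨
    (∃ i, a = vP i ∧ b = vC (conn i 0)) ∨
    (∃ i, a = vR i ∧ b = vC (conn i 1)) ∨
    (∃ i, a = vN i ∧ b = vC (conn i 2))

def G3 (n m : ℕ) (conn : Fin n → Fin 3 → Fin m) : SimpleGraph (VG n m) :=
  SimpleGraph.fromRel (g3Rel n m conn)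

/-- The reload cost function on the colors `1, …, 9`:
`c(1,2) = 1`; `c(1,i) = 1` for `i ∈ {4,5,6}`; `c(2,i) = 1` for `i ∈ {7,8,9}`;
`c(i,j) = 1` for distinct `i, j ∈ {4,…,9}`; all other costs are `0`. -/
def cost57 (x y : ℕ) : ℕ :=
  if (x = 1 ∧ y = 2) ∨ (x = 2 ∧ y = 1) ∨
      (x = 1 ∧ (y = 4 ∨ y = 5 ∨ y = 6)) ∨ ((x = 4 ∨ x = 5 ∨ x = 6) ∧ y = 1) ∨
      (x = 2 ∧ (y = 7 ∨ y = 8 ∨ y = 9)) ∨ ((x = 7 ∨ x = 8 ∨ x = 9) ∧ y = 2) ∨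
      (4 ≤ x ∧ x ≤ 9 ∧ 4 ≤ y ∧ y ≤ 9 ∧ x ≠ y)
  then 1 else 0

noncomputable instance {V : Type*} [Finite V] (G : SimpleGraph V) (v : V) :
    Fintype (G.neighborSet v) := Fintype.ofFinite _

/-- Let `G` be any graph constructed, as in the context, from a CNF formula in which
each variable occurs exactly three times, at least once positively and once
negatively, with any edge-coloring `χ` obeying the prescribed rules. If `T` is a
spanning tree of `G` with reload diameter `0`, then every clause vertex `c_j` has
degree exactly `1` in `T`. -/
theorem stmt7 (n m : ℕ) (cl : Fin m → List (Fin n × Bool))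
    (pos : Fin n → Fin 3 → Fin m × ℕ) (conn : Fin n → Fin 3 → Fin m)
    (χ : Sym2 (VG n m) → ℕ)
    (hsize : ∀ j : Fin m, (cl j).length = 2 ∨ (cl j).length = 3)
    (hocc : ∀ (i : Fin n) (s : Fin 3),
      ∃ b : Bool, (cl (pos i s).1)[(pos i s).2]? = some (i, b))
    (hposocc : ∀ i : Fin n, (cl (pos i 0).1)[(pos i 0).2]? = some (i, true))
    (hnegocc : ∀ i : Fin n, (cl (pos i 2).1)[(pos i 2).2]? = some (i, false))
    (hinj : ∀ (i : Fin n) (s s' : Fin 3), pos i s = pos i s' → s = s')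
    (hcover : ∀ (i : Fin n) (j : Fin m) (t : ℕ) (b : Bool),
      (cl j)[t]? = some (i, b) → ∃ s : Fin 3, pos i s = (j, t))
    (hconn : ∀ (i : Fin n) (s : Fin 3), conn i s = (pos i s).1)
    (hχ1 : ∀ i : Fin n, χ s(vP i, vR i) = 1)
    (hχ2 : ∀ i : Fin n, χ s(vR i, vN i) = 2)
    (hχ3 : ∀ e ∈ (G3 n m conn).edgeSet,
      (∃ i : Fin n, (vU i : VG n m) ∈ e ∨ (vV i : VG n m) ∈ e) → χ e = 3)
    (hχp : ∀ i : Fin n, χ s(vP i, vC (conn i 0)) ∈ ({4, 5, 6} : Set ℕ))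
    (hχn : ∀ i : Fin n, χ s(vN i, vC (conn i 2)) ∈ ({7, 8, 9} : Set ℕ))
    (hχr : ∀ (i : Fin n) (b : Bool), (cl (pos i 1).1)[(pos i 1).2]? = some (i, b) →
      χ s(vR i, vC (conn i 1)) ∈ (if b then ({4, 5, 6} : Set ℕ) else ({7, 8, 9} : Set ℕ)))
    (hχdist : ∀ (j : Fin m) (e e' : Sym2 (VG n m)), e ∈ (G3 n m conn).edgeSet →
      e' ∈ (G3 n m conn).edgeSet → (vC j : VG n m) ∈ e → (vC j : VG n m) ∈ e' →
      e ≠ e' → χ e ≠ χ e')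
    (T : SimpleGraph (VG n m)) (hsub : T ≤ G3 n m conn) (hT : T.IsTree)
    (hdiam : ∀ (u v : VG n m) (p : T.Walk u v), p.IsPath → walkCost χ cost57 p = 0) :
    ∀ j : Fin m, T.degree (vC j : VG n m) = 1 := by
  intro j
  have hcol : ∀ a, T.Adj (vC j) a → 4 ≤ χ s(a, vC j) ∧ χ s(a, vC j) ≤ 9 := by
    intro a ha
    have h := hsub ha
    rw [G3, SimpleGraph.fromRel_adj] at h
    have hP : ∀ i, 4 ≤ χ s(vP i, vC (conn i 0)) ∧ χ s(vP i, vC (conn i 0)) ≤ 9 := by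
      intro i
      have := hχp i
      simp only [Set.mem_insert_iff, Set.mem_singleton_iff] at this
      omega
    have hN : ∀ i, 4 ≤ χ s(vN i, vC (conn i 2)) ∧ χ s(vN i, vC (conn i 2)) ≤ 9 := by
      intro i
      have := hχn i
      simp only [Set.mem_insert_iff, Set.mem_singleton_iff] at this
      omega
    have hR : ∀ i, 4 ≤ χ s(vR i, vC (conn i 1)) ∧ χ s(vR i, vC (conn i 1)) ≤ 9 := by
      intro i
      obtain ⟨b, hb⟩ := hocc i 1
      have := hχr i b hb
      cases b <;> simp at this <;> omega
    obtain ⟨-, h | h⟩ := h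
    · simp [g3Rel, vC, vU, vV, vP, vR, vN] at h
    · rcases h with ⟨i, h1, h2⟩ | ⟨i, h1, h2⟩ | ⟨i, h1, h2⟩ | ⟨i, h1, h2⟩ | ⟨i, h1, h2⟩ |
        ⟨i, _, h1, h2⟩ | ⟨i, h1, h2⟩ | ⟨i, h1, h2⟩ | ⟨i, h1, h2⟩
      · simp [vC, vV] at h2
      · simp [vC, vP] at h2
      · simp [vC, vR] at h2
      · simp [vC, vN] at h2
      · simp [vC, vV] at h2
      · simp [vC, vU] at h2
      · rw [h1, h2]; exact hP i
      · rw [h1, h2]; exact hR i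
      · rw [h1, h2]; exact hN i
  apply le_antisymm
  · rw [← SimpleGraph.card_neighborFinset_eq_degree, Finset.card_le_one]
    intro a ha b hb
    rw [SimpleGraph.mem_neighborFinset] at ha hb
    by_contra hab
    have hp := hdiam a b (.cons ha.symm (.cons hb .nil)) (by
      simp [SimpleGraph.Walk.cons_isPath_iff, ha.ne', hb.ne, hab])
    have hd := hχdist j s(a, vC j) s(b, vC j) (hsub ha.symm) (hsub hb.symm)
      (by simp) (by simp) (by
        intro h
        rw [Sym2.eq_iff] at h
        rcases h with h | h
        · exact hab h.1
        · exact ha.ne' h.1)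
    have h1 := hcol a ha
    have h2 := hcol b hb
    simp only [walkCost, SimpleGraph.Walk.edges_cons, SimpleGraph.Walk.edges_nil, List.map_cons,
      List.map_nil, chainCost, Sym2.eq_swap (a := vC j) (b := b), cost57] at hp
    rw [if_pos (by right; right; right; right; right; right
                   exact ⟨h1.1, h1.2, h2.1, h2.2, hd⟩)] at hp
    omega
  · have hlen : 0 < (cl j).length := by rcases hsize j with h | h <;> omega
    haveI : Nontrivial (VG n m) := ⟨vC j, vU ((cl j)[0]).1, by simp [vC, vU]⟩
    exact hT.connected.preconnected.degree_pos_of_nontrivial _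
end

section
/- Let a_1, …, a_n be positive integers and B = Σ_{i=1}^n a_i. Let G be the graph with reload costs defined in the context. Then G has a spanning tree T with reload diameter diam(T) ≤ B if and only if there exists a set S₁ ⊆ {1, …, n} with 2·Σ_{i∈S₁} a_i = B. -/
/-- Vertices of the graph `G` built from the `Partition` instance: two copies
(indexed by a `Bool`) of the graph `G'`, whose vertices are the root `r = (b, none)`
and, for each `i`, the six vertices `u_i, u_i', m_i, m_i', d_i, d_i'`, encoded as
`(b, some (i, t))` with `t = 0, 1, 2, 3, 4, 5` respectively. -/
abbrev PV (n : ℕ) := Bool × Option (Fin n × Fin 6)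

/-- The edges of `G`: in each copy `b`, the gadget edges `{u_i, u_i'}, {m_i, m_i'},
{d_i, d_i'}, {u_i, m_i}, {u_i', m_i'}, {m_i, d_i}, {m_i', d_i'}`, the root edges
`{r, u_1}, {r, d_1}`, and the path edges `{u_i', u_{i+1}}, {d_i', d_{i+1}}`;
finally the edge between the two roots. -/
def pRel (n : ℕ) : PV n → PV n → Prop := fun a b =>
  (∃ (c : Bool) (i : Fin n), a = (c, some (i, 0)) ∧ b = (c, some (i, 1))) ∨
  (∃ (c : Bool) (i : Fin n), a = (c, some (i, 2)) ∧ b = (c, some (i, 3))) ∨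
  (∃ (c : Bool) (i : Fin n), a = (c, some (i, 4)) ∧ b = (c, some (i, 5))) ∨
  (∃ (c : Bool) (i : Fin n), a = (c, some (i, 0)) ∧ b = (c, some (i, 2))) ∨
  (∃ (c : Bool) (i : Fin n), a = (c, some (i, 1)) ∧ b = (c, some (i, 3))) ∨
  (∃ (c : Bool) (i : Fin n), a = (c, some (i, 2)) ∧ b = (c, some (i, 4))) ∨
  (∃ (c : Bool) (i : Fin n), a = (c, some (i, 3)) ∧ b = (c, some (i, 5))) ∨
  (∃ (c : Bool) (h : 0 < n), a = (c, none) ∧ b = (c, some (⟨0, h⟩, 0))) ∨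
  (∃ (c : Bool) (h : 0 < n), a = (c, none) ∧ b = (c, some (⟨0, h⟩, 4))) ∨
  (∃ (c : Bool) (i : Fin n) (h : i.val + 1 < n),
    a = (c, some (i, 1)) ∧ b = (c, some (⟨i.val + 1, h⟩, 0))) ∨
  (∃ (c : Bool) (i : Fin n) (h : i.val + 1 < n),
    a = (c, some (i, 5)) ∧ b = (c, some (⟨i.val + 1, h⟩, 4))) ∨
  (a = (false, none) ∧ b = (true, none))

def PG (n : ℕ) : SimpleGraph (PV n) := SimpleGraph.fromRel (pRel n)

/-- The edges all of whose incident reload costs are `0`: the path edges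
`{u_i', u_{i+1}}, {d_i', d_{i+1}}`, the root edges `{r, u_1}, {r, d_1}` of each copy,
and the edge between the two roots. -/
def pZeroEdge (n : ℕ) (e : Sym2 (PV n)) : Prop :=
  (∃ (c : Bool) (i : Fin n) (h : i.val + 1 < n),
    e = s(((c, some (i, 1)) : PV n), (c, some (⟨i.val + 1, h⟩, 0)))) ∨
  (∃ (c : Bool) (i : Fin n) (h : i.val + 1 < n),
    e = s(((c, some (i, 5)) : PV n), (c, some (⟨i.val + 1, h⟩, 4)))) ∨
  (∃ (c : Bool) (h : 0 < n), e = s(((c, none) : PV n), (c, some (⟨0, h⟩, 0)))) ∨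
  (∃ (c : Bool) (h : 0 < n), e = s(((c, none) : PV n), (c, some (⟨0, h⟩, 4)))) ∨
  e = s(((false, none) : PV n), ((true, none) : PV n))

open scoped Classical in
/-- The reload cost function of `G`. Each edge has its own distinct color, so colors
are identified with (potential) edges, i.e., elements of `Sym2 (PV n)`. The cost of
the (unordered) pair `{u_i, m_i}, {m_i, m_i'}` and of `{d_i, m_i}, {m_i, m_i'}` is
`a i`; the cost of `{m_i, m_i'}, {m_i', u_i'}` and of `{m_i, m_i'}, {m_i', d_i'}`
is `0`, as is any cost involving a path edge, a root edge, or the edge joining the two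
roots; every other pair of edges has cost `B + 1`. -/
noncomputable def pCost (n : ℕ) (a : Fin n → ℕ) (B : ℕ)
    (e e' : Sym2 (PV n)) : ℕ :=
  if pZeroEdge n e ∨ pZeroEdge n e' ∨
      (∃ (c : Bool) (i : Fin n),
        ({e, e'} : Set (Sym2 (PV n))) =
          {s(((c, some (i, 2)) : PV n), (c, some (i, 3))),
           s(((c, some (i, 3)) : PV n), (c, some (i, 1)))} ∨
        ({e, e'} : Set (Sym2 (PV n))) =
          {s(((c, some (i, 2)) : PV n), (c, some (i, 3))),
           s(((c, some (i, 3)) : PV n), (c, some (i, 5)))})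
  then 0
  else if h : ∃ (c : Bool) (i : Fin n),
      ({e, e'} : Set (Sym2 (PV n))) =
        {s(((c, some (i, 0)) : PV n), (c, some (i, 2))),
         s(((c, some (i, 2)) : PV n), (c, some (i, 3)))} ∨
      ({e, e'} : Set (Sym2 (PV n))) =
        {s(((c, some (i, 4)) : PV n), (c, some (i, 2))),
         s(((c, some (i, 2)) : PV n), (c, some (i, 3)))}
  then a h.choose_spec.choose
  else B + 1

section generic
variable {V : Type*}

def ParG (par : V → V) (root : V) : SimpleGraph V :=
  SimpleGraph.fromRel (fun x y => x ≠ root ∧ par x = y)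

/-- `v` is the lower endpoint of the edge `x z`. -/
def EdgeOf (par : V → V) (root v x z : V) : Prop :=
  v ≠ root ∧ ((x = v ∧ z = par v) ∨ (z = v ∧ x = par v))

theorem ParG_edgeOf {par : V → V} {root x z : V} (h : (ParG par root).Adj x z) :
    ∃ v, EdgeOf par root v x z := by
  rw [ParG, SimpleGraph.fromRel_adj] at h
  rcases h with ⟨_, ⟨h1, h2⟩ | ⟨h1, h2⟩⟩
  · exact ⟨x, h1, Or.inl ⟨rfl, h2.symm⟩⟩
  · exact ⟨z, h1, Or.inr ⟨rfl, h2.symm⟩⟩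

theorem ParG_adj {par : V → V} {root : V} (rank : V → ℕ)
    (hr : ∀ v, v ≠ root → rank (par v) < rank v) {v : V} (hv : v ≠ root) :
    (ParG par root).Adj v (par v) := by
  rw [ParG, SimpleGraph.fromRel_adj]
  refine ⟨?_, Or.inl ⟨hv, rfl⟩⟩
  intro h
  have := hr v hv
  rw [← h] at this
  exact lt_irrefl _ this

theorem ParG_conn {par : V → V} {root : V} (rank : V → ℕ)
    (hr : ∀ v, v ≠ root → rank (par v) < rank v) : (ParG par root).Connected := by
  have key : ∀ k v, rank v ≤ k → (ParG par root).Reachable v root := by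
    intro k
    induction k with
    | zero =>
      intro v hv
      by_cases h : v = root
      · rw [h]
      · have := hr v h; omega
    | succ k ih =>
      intro v hv
      by_cases h : v = root
      · rw [h]
      · have := hr v h
        exact (ParG_adj rank hr h).reachable.trans (ih _ (by omega))
  have : Nonempty V := ⟨root⟩
  exact ⟨fun u v => (key _ u le_rfl).trans (key _ v le_rfl).symm⟩

theorem ParG_tree [Fintype V] {par : V → V} {root : V} (rank : V → ℕ)
    (hr : ∀ v, v ≠ root → rank (par v) < rank v) : (ParG par root).IsTree := by
  classical
  have hc := ParG_conn rank hr
  rw [SimpleGraph.isTree_iff_connected_and_card]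
  refine ⟨hc, le_antisymm ?_ ?_⟩
  · have hsub : (ParG par root).edgeSet ⊆
        (((Finset.univ.erase root).image (fun v => s(v, par v)) : Finset (Sym2 V)) : Set (Sym2 V)) := by
      intro e he
      induction e using Sym2.ind with
      | _ x y =>
        rw [SimpleGraph.mem_edgeSet] at he
        obtain ⟨v, hv, ⟨rfl, rfl⟩ | ⟨rfl, rfl⟩⟩ := ParG_edgeOf he
        · simp only [Finset.coe_image, Set.mem_image, Finset.mem_coe, Finset.mem_erase]
          exact ⟨x, ⟨hv, Finset.mem_univ _⟩, rfl⟩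
        · simp only [Finset.coe_image, Set.mem_image, Finset.mem_coe, Finset.mem_erase]
          exact ⟨y, ⟨hv, Finset.mem_univ _⟩, Sym2.eq_swap⟩
    have h1 := Nat.card_mono (Finset.finite_toSet _) hsub
    have h2 : Nat.card (((Finset.univ.erase root).image (fun v => s(v, par v)) : Finset (Sym2 V)) : Set (Sym2 V)) ≤ Fintype.card V - 1 := by
      rw [Nat.card_coe_set_eq, Set.ncard_coe_finset]
      refine Finset.card_image_le.trans ?_
      rw [Finset.card_erase_of_mem (Finset.mem_univ _), Finset.card_univ]
    have h3 : 0 < Fintype.card V := Fintype.card_pos_iff.2 ⟨root⟩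
    rw [Nat.card_eq_fintype_card (α := V)]
    omega
  · exact hc.card_vert_le_card_edgeSet_add_one

theorem walkCost_cons_cons {G : SimpleGraph V} (c : Sym2 V → Sym2 V → ℕ) {x y z w : V}
    (h : G.Adj x y) (h' : G.Adj y z) (p : G.Walk z w) :
    walkCost id c (.cons h (.cons h' p)) =
      c s(x, y) s(y, z) + walkCost id c (.cons h' p) := by
  simp [walkCost, chainCost]

theorem walkCost_single {G : SimpleGraph V} (c : Sym2 V → Sym2 V → ℕ) {x y : V}
    (h : G.Adj x y) :
    walkCost id c (.cons h .nil) = 0 := by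
  simp [walkCost, chainCost]

theorem lower_bound {par : V → V} {root : V} (c : Sym2 V → Sym2 V → ℕ)
    (hc : ∀ e e', c e e' = c e' e) (μ : V → ℤ)
    (h1 : ∀ v, v ≠ root → par v ≠ root →
      |μ v - μ (par v)| ≤ c s(v, par v) s(par v, par (par v)))
    (h2 : ∀ v w, v ≠ root → w ≠ root → par v = par w → μ v = μ w)
    {y : V} (hy : ∀ v, v ≠ root → par v ≠ y) {z : V} (p : (ParG par root).Walk z y) :
    ∀ (x v : V) (h : (ParG par root).Adj x z), EdgeOf par root v x z →
      μ y ≤ μ v + walkCost id c (.cons h p) := by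
  induction p with
  | nil =>
    intro x v h hv
    rw [walkCost_single]
    obtain ⟨hv, ⟨rfl, h3⟩ | ⟨rfl, rfl⟩⟩ := hv
    · exact absurd h3.symm (hy _ hv)
    · simp
  | @cons z w y h' p ih =>
    intro x v h hv
    obtain ⟨v', hv'⟩ := ParG_edgeOf h'
    have h3 := ih hy z v' h' hv'
    rw [walkCost_cons_cons]
    push_cast
    suffices hs : μ v' ≤ μ v + c s(x, z) s(z, w) by linarith
    obtain ⟨hv, ⟨rfl, rfl⟩ | ⟨rfl, rfl⟩⟩ := hv
    · obtain ⟨hv', ⟨h4, rfl⟩ | ⟨rfl, h4⟩⟩ := hv'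
      · subst h4
        have := (abs_le.1 (h1 x hv hv')).1
        linarith
      · have := h2 _ _ hv hv' h4
        have h5 : (0 : ℤ) ≤ c s(x, par x) s(par x, w) := by positivity
        linarith
    · obtain ⟨hv', ⟨h4, rfl⟩ | ⟨rfl, h4⟩⟩ := hv'
      · subst h4
        have h5 : (0 : ℤ) ≤ c s(par z, z) s(z, par z) := by positivity
        linarith
      · subst h4
        have h6 := (abs_le.1 (h1 w hv' hv)).2
        rw [hc, Sym2.eq_swap (a := par w), Sym2.eq_swap (a := w)] at h6
        linarith

theorem upper_bound {par : V → V} {root : V} (c : Sym2 V → Sym2 V → ℕ)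
    (hc : ∀ e e', c e e' = c e' e) (C : V → ℕ)
    (h0 : ∀ v, v ≠ root → C (par v) ≤ C v)
    (h1 : ∀ v, v ≠ root → par v ≠ root →
      C (par v) + c s(v, par v) s(par v, par (par v)) ≤ C v)
    (h2 : ∀ v w, v ≠ root → w ≠ root → v ≠ w → par v = par w →
      c s(v, par v) s(w, par w) = 0)
    {x y : V} (p : (ParG par root).Walk x y) (hp : p.IsPath) :
    walkCost id c p ≤ C x + C y ∧
      (∀ (w z : V) (h : (ParG par root).Adj w x), z = w → (SimpleGraph.Walk.cons h p).IsPath →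
        x ≠ root → par x = w → walkCost id c (.cons h p) + C x ≤ C y) := by
  induction p with
  | nil =>
    refine ⟨by simp [walkCost, chainCost], ?_⟩
    intro w z h _ _ _ _
    rw [walkCost_single]; simp
  | @cons x z y h p ih =>
    have hpp := hp.of_cons
    obtain ⟨ih1, ih2⟩ := ih hpp
    constructor
    · obtain ⟨v, hv, ⟨h3, h4⟩ | ⟨h3, h4⟩⟩ := ParG_edgeOf h
      · subst h3
        have h00 := h0 x hv
        cases p with
        | nil => rw [walkCost_single]; simp
        | @cons _ w _ h' q =>
          rw [walkCost_cons_cons]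
          obtain ⟨v', hv', ⟨h5, h6⟩ | ⟨h5, h6⟩⟩ := ParG_edgeOf h'
          · subst h5 h6 
            have := h1 x hv (by rw [← h4]; exact hv')
            rw [← h4] at this
            omega
          · subst h5
            have hne : x ≠ w := by
              rintro rfl
              simp [SimpleGraph.Walk.cons_isPath_iff] at hp
            have := h2 x w hv hv' hne (by rw [← h4, h6])
            rw [← h4, ← h6, Sym2.eq_swap (a := w)] at this
            rw [this]
            rw [← h4] at h00
            omega
      · subst h3
        have := ih2 x x h rfl hp hv h4.symm
        omega
    · intro w _ h' _ hp' hx hxw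
      rw [walkCost_cons_cons]
      obtain ⟨v, hv, ⟨h3, h4⟩ | ⟨h3, h4⟩⟩ := ParG_edgeOf h
      · subst h3
        exfalso
        rw [hxw] at h4
        subst h4
        simp [SimpleGraph.Walk.cons_isPath_iff] at hp'
      · subst h3
        have h5 := ih2 x x h rfl hp hv h4.symm
        have h6 := h1 z hv (by rw [← h4]; exact hx)
        rw [← h4, hxw, hc, Sym2.eq_swap (a := x), Sym2.eq_swap (a := z)] at h6
        omega

end generic
section concrete
variable {n : ℕ}

theorem pCost_symm (a : Fin n → ℕ) (B : ℕ) (e e' : Sym2 (PV n)) :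
    pCost n a B e e' = pCost n a B e' e := by
  unfold pCost
  classical
  refine if_congr ?_ rfl ?_
  · rw [Set.pair_comm e e', or_left_comm]
  · simp only [Set.pair_comm e e']

theorem pCost_zero_left (a : Fin n → ℕ) (B : ℕ) {e e' : Sym2 (PV n)} (h : pZeroEdge n e) :
    pCost n a B e e' = 0 := by
  unfold pCost
  rw [if_pos (Or.inl h)]

theorem pCost_zero_right (a : Fin n → ℕ) (B : ℕ) {e e' : Sym2 (PV n)} (h : pZeroEdge n e') :
    pCost n a B e e' = 0 := by
  unfold pCost
  rw [if_pos (Or.inr (Or.inl h))]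

theorem pCost_31 (a : Fin n → ℕ) (B : ℕ) (b : Bool) (i : Fin n) :
    pCost n a B s((b, some (i, 1)), (b, some (i, 3))) s((b, some (i, 3)), (b, some (i, 2))) = 0 := by
  unfold pCost
  rw [if_pos]
  refine Or.inr (Or.inr ⟨b, i, Or.inl ?_⟩)
  rw [Set.pair_comm, Sym2.eq_swap, Sym2.eq_swap (a := (b, some (i, 1)))]

theorem pCost_35 (a : Fin n → ℕ) (B : ℕ) (b : Bool) (i : Fin n) :
    pCost n a B s((b, some (i, 5)), (b, some (i, 3))) s((b, some (i, 3)), (b, some (i, 2))) = 0 := by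
  unfold pCost
  rw [if_pos]
  refine Or.inr (Or.inr ⟨b, i, Or.inr ?_⟩)
  rw [Set.pair_comm, Sym2.eq_swap, Sym2.eq_swap (a := (b, some (i, 5)))]

theorem pCost_20 (a : Fin n → ℕ) (B : ℕ) (b : Bool) (i : Fin n) :
    pCost n a B s((b, some (i, 3)), (b, some (i, 2))) s((b, some (i, 2)), (b, some (i, 0))) = a i := by
  unfold pCost
  rw [if_neg]
  · have h : ∃ (c : Bool) (j : Fin n),
      ({s((b, some (i, 3)), (b, some (i, 2))), s((b, some (i, 2)), (b, some (i, 0)))} : Set (Sym2 (PV n))) =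
        {s(((c, some (j, 0)) : PV n), (c, some (j, 2))),
         s(((c, some (j, 2)) : PV n), (c, some (j, 3)))} ∨
      ({s((b, some (i, 3)), (b, some (i, 2))), s((b, some (i, 2)), (b, some (i, 0)))} : Set (Sym2 (PV n))) =
        {s(((c, some (j, 4)) : PV n), (c, some (j, 2))),
         s(((c, some (j, 2)) : PV n), (c, some (j, 3)))} := by
      refine ⟨b, i, Or.inl ?_⟩
      rw [Set.pair_comm, Sym2.eq_swap, Sym2.eq_swap (a := (b, some (i, 3)))]
    rw [dif_pos h]
    have := h.choose_spec.choose_spec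
    generalize h.choose_spec.choose = j at this
    generalize h.choose = c at this
    simp [Set.pair_eq_pair_iff] at this
    rw [this.2]
  · simp [pZeroEdge, Set.pair_eq_pair_iff]

theorem pCost_24 (a : Fin n → ℕ) (B : ℕ) (b : Bool) (i : Fin n) :
    pCost n a B s((b, some (i, 3)), (b, some (i, 2))) s((b, some (i, 2)), (b, some (i, 4))) = a i := by
  unfold pCost
  rw [if_neg]
  · have h : ∃ (c : Bool) (j : Fin n),
      ({s((b, some (i, 3)), (b, some (i, 2))), s((b, some (i, 2)), (b, some (i, 4)))} : Set (Sym2 (PV n))) =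
        {s(((c, some (j, 0)) : PV n), (c, some (j, 2))),
         s(((c, some (j, 2)) : PV n), (c, some (j, 3)))} ∨
      ({s((b, some (i, 3)), (b, some (i, 2))), s((b, some (i, 2)), (b, some (i, 4)))} : Set (Sym2 (PV n))) =
        {s(((c, some (j, 4)) : PV n), (c, some (j, 2))),
         s(((c, some (j, 2)) : PV n), (c, some (j, 3)))} := by
      refine ⟨b, i, Or.inr ?_⟩
      rw [Set.pair_comm, Sym2.eq_swap, Sym2.eq_swap (a := (b, some (i, 3)))]
    rw [dif_pos h]
    have := h.choose_spec.choose_spec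
    generalize h.choose_spec.choose = j at this
    generalize h.choose = c at this
    simp [Set.pair_eq_pair_iff] at this
    rw [this.2]
  · simp [pZeroEdge, Set.pair_eq_pair_iff]

theorem pCost_bad (a : Fin n → ℕ) (B : ℕ) (b : Bool) (i : Fin n) (x y z : Fin 6)
    (h : (x, y, z) ∈ ([(1, 0, 2), (0, 1, 3), (1, 3, 5), (3, 5, 4), (5, 4, 2), (4, 2, 0)] :
      List (Fin 6 × Fin 6 × Fin 6))) :
    pCost n a B s((b, some (i, x)), (b, some (i, y))) s((b, some (i, y)), (b, some (i, z))) = B + 1 := by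
  unfold pCost
  simp only [List.mem_cons, List.not_mem_nil, or_false, Prod.mk.injEq] at h
  rcases h with h | h | h | h | h | h <;> obtain ⟨rfl, rfl, rfl⟩ := h <;>
  · rw [if_neg, dif_neg]
    · simp [Set.pair_eq_pair_iff]
    · simp [pZeroEdge, Set.pair_eq_pair_iff]
      try (intro _ h; simp [Fin.ext_iff] at h)

def ent (b : Bool) (i : Fin n) (o : Fin 6) : PV n :=
  if i.val = 0 then (b, none) else (b, some (⟨i.val - 1, by omega⟩, o))

def par (S : Bool → Finset (Fin n)) : PV n → PV n
  | (_, none) => (false, none)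
  | (b, some (i, 0)) => ent b i 1
  | (b, some (i, 1)) => if i ∈ S b then (b, some (i, 3)) else (b, some (i, 0))
  | (b, some (i, 2)) => if i ∈ S b then (b, some (i, 0)) else (b, some (i, 4))
  | (b, some (i, 3)) => (b, some (i, 2))
  | (b, some (i, 4)) => ent b i 5
  | (b, some (i, 5)) => if i ∈ S b then (b, some (i, 4)) else (b, some (i, 3))

def pref (a : Fin n → ℕ) (S : Finset (Fin n)) (k : ℕ) : ℕ :=
  ∑ j ∈ S.filter (fun j => j.val < k), a j

def CC (a : Fin n → ℕ) (S : Bool → Finset (Fin n)) : PV n → ℕ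
  | (_, none) => 0
  | (b, some (i, 0)) => pref a (S b) i
  | (b, some (i, 1)) => pref a (S b) (i + 1)
  | (b, some (i, 2)) => if i ∈ S b then pref a (S b) i else pref a (S b)ᶜ i
  | (b, some (i, 3)) => if i ∈ S b then pref a (S b) (i + 1) else pref a (S b)ᶜ (i + 1)
  | (b, some (i, 4)) => pref a (S b)ᶜ i
  | (b, some (i, 5)) => pref a (S b)ᶜ (i + 1)

def rk : PV n → ℕ
  | (false, none) => 0
  | (true, none) => 1
  | (_, some (i, 0)) => 6 * i + 2
  | (_, some (i, 1)) => 6 * i + 5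
  | (_, some (i, 2)) => 6 * i + 3
  | (_, some (i, 3)) => 6 * i + 4
  | (_, some (i, 4)) => 6 * i + 2
  | (_, some (i, 5)) => 6 * i + 5

theorem fin6 : ∀ t : Fin 6, t = 0 ∨ t = 1 ∨ t = 2 ∨ t = 3 ∨ t = 4 ∨ t = 5 := by decide

theorem pref_zero (a : Fin n → ℕ) (S : Finset (Fin n)) : pref a S 0 = 0 := by
  simp [pref]

theorem pref_succ (a : Fin n → ℕ) (S : Finset (Fin n)) (i : Fin n) :
    pref a S (i + 1) = pref a S i + if i ∈ S then a i else 0 := by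
  unfold pref
  split_ifs with h
  · have : S.filter (fun j => j.val < i.val + 1) = insert i (S.filter (fun j => j.val < i.val)) := by
      ext j
      simp only [Finset.mem_filter, Finset.mem_insert, Fin.ext_iff]
      constructor
      · rintro ⟨h1, h2⟩
        by_cases h3 : j.val = i
        · exact Or.inl h3
        · exact Or.inr ⟨h1, by omega⟩
      · rintro (h1 | h1)
        · exact ⟨by rwa [Fin.ext h1], by omega⟩
        · exact ⟨h1.1, by omega⟩
    rw [this, Finset.sum_insert (by simp), add_comm]
  · rw [add_zero]
    congr 1
    ext j
    simp only [Finset.mem_filter]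
    constructor
    · rintro ⟨h1, h2⟩
      refine ⟨h1, ?_⟩
      have : j.val ≠ i := by
        intro h3
        exact h (by rwa [← Fin.ext h3])
      omega
    · rintro ⟨h1, h2⟩
      exact ⟨h1, by omega⟩

theorem pref_le (a : Fin n → ℕ) (S : Finset (Fin n)) (k : ℕ) : pref a S k ≤ ∑ i ∈ S, a i :=
  Finset.sum_le_sum_of_subset (Finset.filter_subset _ _)

theorem pref_full (a : Fin n → ℕ) (S : Finset (Fin n)) : pref a S n = ∑ i ∈ S, a i := by
  unfold pref
  rw [Finset.filter_true_of_mem]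
  intro j _
  exact j.2

theorem zero_ent0 (b : Bool) (i : Fin n) : pZeroEdge n s((b, some (i, 0)), ent b i 1) := by
  unfold ent pZeroEdge
  obtain ⟨i, hi⟩ := i
  split_ifs with h
  · simp only at h
    subst h
    exact Or.inr (Or.inr (Or.inl ⟨b, hi, Sym2.eq_swap⟩))
  · refine Or.inl ⟨b, ⟨i - 1, by omega⟩, ?_, ?_⟩
    · simp only at h ⊢; omega
    · rw [Sym2.eq_swap]
      simp only at h
      have : i - 1 + 1 = i := by omega
      simp [this]

theorem zero_ent4 (b : Bool) (i : Fin n) : pZeroEdge n s((b, some (i, 4)), ent b i 5) := by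
  unfold ent pZeroEdge
  obtain ⟨i, hi⟩ := i
  split_ifs with h
  · simp only at h
    subst h
    exact Or.inr (Or.inr (Or.inr (Or.inl ⟨b, hi, Sym2.eq_swap⟩)))
  · refine Or.inr (Or.inl ⟨b, ⟨i - 1, by omega⟩, ?_, ?_⟩)
    · simp only at h ⊢; omega
    · rw [Sym2.eq_swap]
      simp only at h
      have : i - 1 + 1 = i := by omega
      simp [this]

theorem zero_root : pZeroEdge n s((true, none), (false, none)) :=
  Or.inr (Or.inr (Or.inr (Or.inr Sym2.eq_swap)))

theorem CC_ent1 (a : Fin n → ℕ) (S : Bool → Finset (Fin n)) (b : Bool) (i : Fin n) :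
    CC a S (ent b i 1) = pref a (S b) i := by
  unfold ent
  split_ifs with h
  · rw [h, pref_zero]; rfl
  · simp only [CC]
    congr 1
    omega

theorem CC_ent5 (a : Fin n → ℕ) (S : Bool → Finset (Fin n)) (b : Bool) (i : Fin n) :
    CC a S (ent b i 5) = pref a (S b)ᶜ i := by
  unfold ent
  split_ifs with h
  · rw [h, pref_zero]; rfl
  · simp only [CC]
    congr 1
    omega

theorem rk_par (S : Bool → Finset (Fin n)) (v : PV n) (hv : v ≠ (false, none)) :
    rk (par S v) < rk v := by
  obtain ⟨b, _ | ⟨i, t⟩⟩ := v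
  · cases b
    · exact absurd rfl hv
    · simp [par, rk]
  · rcases fin6 t with rfl | rfl | rfl | rfl | rfl | rfl <;> simp only [par, ent] <;>
    (try split_ifs) <;> cases b <;> simp [rk] <;> omega

theorem F3 (a : Fin n → ℕ) (B : ℕ) (S : Bool → Finset (Fin n)) (v : PV n)
    (hv : v ≠ (false, none)) (hv' : par S v ≠ (false, none)) :
    CC a S (par S v) + pCost n a B s(v, par S v) s(par S v, par S (par S v)) = CC a S v := by
  obtain ⟨b, _ | ⟨i, t⟩⟩ := v
  · exact absurd rfl hv'
  · rcases fin6 t with rfl | rfl | rfl | rfl | rfl | rfl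
    · simp only [par]
      rw [pCost_zero_left _ _ (zero_ent0 b i), CC_ent1]
      simp [CC]
    · by_cases h : i ∈ S b
      · simp only [par, h, if_true]
        rw [pCost_31]
        simp [CC, h]
      · simp only [par, h, if_false]
        rw [pCost_zero_right _ _ (zero_ent0 b i)]
        simp [CC, pref_succ, h]
    · by_cases h : i ∈ S b
      · simp only [par, h, if_true]
        rw [pCost_zero_right _ _ (zero_ent0 b i)]
        simp [CC, h]
      · simp only [par, h, if_false]
        rw [pCost_zero_right _ _ (zero_ent4 b i)]
        simp [CC, h]
    · by_cases h : i ∈ S b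
      · simp only [par, h, if_true]
        rw [pCost_20]
        simp [CC, h, pref_succ]
      · simp only [par, h, if_false]
        rw [pCost_24]
        simp [CC, h, pref_succ]
    · simp only [par]
      rw [pCost_zero_left _ _ (zero_ent4 b i), CC_ent5]
      simp [CC]
    · by_cases h : i ∈ S b
      · simp only [par, h, if_true]
        rw [pCost_zero_right _ _ (zero_ent4 b i)]
        simp [CC, pref_succ, h]
      · simp only [par, h, if_false]
        rw [pCost_35]
        simp [CC, h]

/-- children of roots -/
theorem par_none (a : Fin n → ℕ) (S : Bool → Finset (Fin n)) (v : PV n) (b : Bool)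
    (hv : v ≠ (false, none)) (h : par S v = (b, none)) :
    pZeroEdge n s(v, par S v) ∧ CC a S v = 0 := by
  obtain ⟨b', _ | ⟨i, t⟩⟩ := v
  · cases b'
    · exact absurd rfl hv
    · exact ⟨zero_root, rfl⟩
  · rcases fin6 t with rfl | rfl | rfl | rfl | rfl | rfl <;> simp only [par] at h ⊢
    · refine ⟨zero_ent0 _ _, ?_⟩
      rw [show CC a S (b', some (i, 0)) = CC a S (ent b' i 1) by rw [CC_ent1]; rfl, h]; rfl
    · split_ifs at h <;> simp at h
    · split_ifs at h <;> simp at h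
    · simp at h
    · refine ⟨zero_ent4 _ _, ?_⟩
      rw [show CC a S (b', some (i, 4)) = CC a S (ent b' i 5) by rw [CC_ent5]; rfl, h]; rfl
    · split_ifs at h <;> simp at h

theorem par_some (S : Bool → Finset (Fin n)) (v w : PV n) (b : Bool) (q : Fin n × Fin 6)
    (h : par S v = (b, some q)) (h' : par S w = (b, some q)) : v = w := by
  obtain ⟨b₁, _ | ⟨i, t⟩⟩ := v
  · simp [par] at h
  obtain ⟨b₂, _ | ⟨j, s⟩⟩ := w
  · simp [par] at h'
  obtain ⟨k, q⟩ := q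
  rcases fin6 t with rfl | rfl | rfl | rfl | rfl | rfl <;> simp only [par, ent] at h <;>
    rcases fin6 s with rfl | rfl | rfl | rfl | rfl | rfl <;> simp only [par, ent] at h' <;>
    grind

theorem F4 (a : Fin n → ℕ) (B : ℕ) (S : Bool → Finset (Fin n)) (v w : PV n)
    (hv : v ≠ (false, none)) (hw : w ≠ (false, none)) (h : par S v = par S w) :
    v = w ∨ (CC a S v = 0 ∧ CC a S w = 0 ∧ pCost n a B s(v, par S v) s(w, par S w) = 0) := by
  rcases hq : par S v with ⟨b, _ | q⟩
  · have h1 := par_none a S v b hv hq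
    have h2 := par_none a S w b hw (h ▸ hq)
    exact Or.inr ⟨h1.2, h2.2, by rw [← hq]; exact pCost_zero_left _ _ h1.1⟩
  · exact Or.inl (par_some S v w b q hq (h ▸ hq))

theorem CC_le (a : Fin n → ℕ) (S : Bool → Finset (Fin n)) (v : PV n) (M : ℕ)
    (h1 : ∀ b, ∑ i ∈ S b, a i ≤ M) (h2 : ∀ b, ∑ i ∈ (S b)ᶜ, a i ≤ M) : CC a S v ≤ M := by
  obtain ⟨b, _ | ⟨i, t⟩⟩ := v
  · simp [CC]
  · have h3 := fun k => (pref_le a (S b) k).trans (h1 b)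
    have h4 := fun k => (pref_le a (S b)ᶜ k).trans (h2 b)
    rcases fin6 t with rfl | rfl | rfl | rfl | rfl | rfl <;> simp only [CC] <;>
    (try split_ifs) <;> first | exact h3 _ | exact h4 _

theorem ParG_le (S : Bool → Finset (Fin n)) (T : SimpleGraph (PV n))
    (h0 : T.Adj (true, none) (false, none))
    (h1 : ∀ b i, T.Adj (b, some (i, 0)) (ent b i 1))
    (h2 : ∀ b i, T.Adj (b, some (i, 4)) (ent b i 5))
    (h3 : ∀ b i, T.Adj (b, some (i, 3)) (b, some (i, 2)))
    (h4 : ∀ b i, i ∈ S b → T.Adj (b, some (i, 1)) (b, some (i, 3)) ∧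
      T.Adj (b, some (i, 2)) (b, some (i, 0)) ∧ T.Adj (b, some (i, 5)) (b, some (i, 4)))
    (h5 : ∀ b i, i ∉ S b → T.Adj (b, some (i, 1)) (b, some (i, 0)) ∧
      T.Adj (b, some (i, 2)) (b, some (i, 4)) ∧ T.Adj (b, some (i, 5)) (b, some (i, 3))) :
    ParG (par S) (false, none) ≤ T := by
  have key : ∀ v, v ≠ (false, none) → T.Adj v (par S v) := by
    intro v hv
    obtain ⟨b, _ | ⟨i, t⟩⟩ := v
    · cases b
      · exact absurd rfl hv
      · exact h0
    · rcases fin6 t with rfl | rfl | rfl | rfl | rfl | rfl <;> simp only [par]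
      · exact h1 b i
      · split_ifs with h
        · exact (h4 b i h).1
        · exact (h5 b i h).1
      · split_ifs with h
        · exact (h4 b i h).2.1
        · exact (h5 b i h).2.1
      · exact h3 b i
      · exact h2 b i
      · split_ifs with h
        · exact (h4 b i h).2.2
        · exact (h5 b i h).2.2
  intro x y hxy
  obtain ⟨v, hv, ⟨rfl, rfl⟩ | ⟨rfl, rfl⟩⟩ := ParG_edgeOf hxy
  · exact key _ hv
  · exact (key _ hv).symm

theorem ne_ent (b : Bool) (i : Fin n) (s t : Fin 6) (h : s ≠ t) :
    ((b, some (i, s)) : PV n) ≠ ent b i t := by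
  unfold ent
  split_ifs <;> simp [h]

theorem ParG_le_PG (S : Bool → Finset (Fin n)) : ParG (par S) (false, none) ≤ PG n := by
  have aux : ∀ x y : PV n, x ≠ y → pRel n y x → (PG n).Adj x y := by
    intro x y h1 h2
    rw [PG, SimpleGraph.fromRel_adj]
    exact ⟨h1, Or.inr h2⟩
  have aux' : ∀ x y : PV n, x ≠ y → pRel n x y → (PG n).Adj x y := by
    intro x y h1 h2
    rw [PG, SimpleGraph.fromRel_adj]
    exact ⟨h1, Or.inl h2⟩
  apply ParG_le
  · exact aux _ _ (by simp) (by simp [pRel])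
  · intro b i
    refine aux _ _ (ne_ent _ _ _ _ (by decide)) ?_
    unfold ent
    obtain ⟨i, hi⟩ := i
    split_ifs with h
    · simp only at h
      subst h
      simp [pRel, hi]
    · simp only at h
      have h3 : i - 1 + 1 = i := by omega
      simp [pRel, h3, hi]
  · intro b i
    refine aux _ _ (ne_ent _ _ _ _ (by decide)) ?_
    unfold ent
    obtain ⟨i, hi⟩ := i
    split_ifs with h
    · simp only at h
      subst h
      simp [pRel, hi]
    · simp only at h
      have h3 : i - 1 + 1 = i := by omega
      simp [pRel, h3, hi]
  · intro b i
    exact aux _ _ (by simp) (by simp [pRel])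
  · intro b i _
    exact ⟨aux' _ _ (by simp) (by simp [pRel]), aux _ _ (by simp) (by simp [pRel]),
      aux _ _ (by simp) (by simp [pRel])⟩
  · intro b i _
    exact ⟨aux _ _ (by simp) (by simp [pRel]), aux' _ _ (by simp) (by simp [pRel]),
      aux _ _ (by simp) (by simp [pRel])⟩

def lab : Option ((Bool × Fin n) × Fin 9) → Sym2 (PV n)
  | none => s((true, none), (false, none))
  | some ((b, i), 0) => s((b, some (i, 0)), (b, some (i, 1)))
  | some ((b, i), 1) => s((b, some (i, 2)), (b, some (i, 3)))
  | some ((b, i), 2) => s((b, some (i, 4)), (b, some (i, 5)))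
  | some ((b, i), 3) => s((b, some (i, 0)), (b, some (i, 2)))
  | some ((b, i), 4) => s((b, some (i, 1)), (b, some (i, 3)))
  | some ((b, i), 5) => s((b, some (i, 2)), (b, some (i, 4)))
  | some ((b, i), 6) => s((b, some (i, 3)), (b, some (i, 5)))
  | some ((b, i), 7) => s((b, some (i, 0)), ent b i 1)
  | some ((b, i), 8) => s((b, some (i, 4)), ent b i 5)

theorem pRel_lab (x y : PV n) (h : pRel n x y) : ∃ l, lab l = s(x, y) := by
  unfold pRel at h
  rcases h with ⟨b, i, rfl, rfl⟩ | ⟨b, i, rfl, rfl⟩ | ⟨b, i, rfl, rfl⟩ | ⟨b, i, rfl, rfl⟩ |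
    ⟨b, i, rfl, rfl⟩ | ⟨b, i, rfl, rfl⟩ | ⟨b, i, rfl, rfl⟩ | ⟨b, i, rfl, rfl⟩ | ⟨b, i, rfl, rfl⟩ |
    ⟨b, i, hi, rfl, rfl⟩ | ⟨b, i, hi, rfl, rfl⟩ | ⟨rfl, rfl⟩
  · exact ⟨some ((b, i), 0), rfl⟩
  · exact ⟨some ((b, i), 1), rfl⟩
  · exact ⟨some ((b, i), 2), rfl⟩
  · exact ⟨some ((b, i), 3), rfl⟩
  · exact ⟨some ((b, i), 4), rfl⟩
  · exact ⟨some ((b, i), 5), rfl⟩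
  · exact ⟨some ((b, i), 6), rfl⟩
  · exact ⟨some ((b, ⟨0, i⟩), 7), by simp [lab, ent]⟩
  · exact ⟨some ((b, ⟨0, i⟩), 8), by simp [lab, ent]⟩
  · exact ⟨some ((b, ⟨i + 1, hi⟩), 7), by simp [lab, ent]⟩
  · exact ⟨some ((b, ⟨i + 1, hi⟩), 8), by simp [lab, ent]⟩
  · exact ⟨none, Sym2.eq_swap⟩

theorem no_bad (a : Fin n → ℕ) (B : ℕ) (T : SimpleGraph (PV n))
    (hT : ∀ (u v : PV n) (p : T.Walk u v), p.IsPath → walkCost id (pCost n a B) p ≤ B)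
    (b : Bool) (i : Fin n) (x y z : Fin 6)
    (h : (x, y, z) ∈ ([(1, 0, 2), (0, 1, 3), (1, 3, 5), (3, 5, 4), (5, 4, 2), (4, 2, 0)] :
      List (Fin 6 × Fin 6 × Fin 6))) :
    ¬ (T.Adj (b, some (i, x)) (b, some (i, y)) ∧ T.Adj (b, some (i, y)) (b, some (i, z))) := by
  rintro ⟨h1, h2⟩
  have hxz : x ≠ z := by
    simp only [List.mem_cons, List.not_mem_nil, or_false, Prod.mk.injEq] at h
    rcases h with h | h | h | h | h | h <;> obtain ⟨rfl, rfl, rfl⟩ := h <;> decide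
  have h3 := hT _ _ (.cons h1 (.cons h2 .nil)) (by
    have := h1.ne
    have := h2.ne
    simp_all [SimpleGraph.Walk.cons_isPath_iff])
  rw [walkCost_cons_cons, walkCost_single, pCost_bad a B b i x y z h] at h3
  omega

open scoped Classical in
theorem structure_T (a : Fin n → ℕ) (B : ℕ) (T : SimpleGraph (PV n)) (hle : T ≤ PG n)
    (htree : T.IsTree)
    (hT : ∀ (u v : PV n) (p : T.Walk u v), p.IsPath → walkCost id (pCost n a B) p ≤ B) :
    ∃ S : Bool → Finset (Fin n), ParG (par S) (false, none) ≤ T := by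
  let ind : Option ((Bool × Fin n) × Fin 9) → ℕ := fun l => if lab l ∈ T.edgeSet then 1 else 0
  have hind : ∀ l, ind l ≤ 1 := by intro l; simp only [ind]; split_ifs <;> simp
  have hcard : 2 * (n * 6 + 1) ≤ ∑ l, ind l + 1 := by
    have h1 := htree.card_edgeFinset
    have h2 : T.edgeFinset ⊆ (Finset.univ.filter (fun l => lab l ∈ T.edgeSet)).image lab := by
      intro e he
      rw [SimpleGraph.mem_edgeFinset] at he
      simp only [Finset.mem_image, Finset.mem_filter, Finset.mem_univ, true_and]
      suffices h : ∃ l, lab l = e by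
        obtain ⟨l, rfl⟩ := h
        exact ⟨l, he, rfl⟩
      induction e using Sym2.ind with
      | _ x y =>
        have := hle (SimpleGraph.mem_edgeSet _ |>.1 he)
        rw [PG, SimpleGraph.fromRel_adj] at this
        rcases this with ⟨_, h | h⟩
        · exact pRel_lab _ _ h
        · rw [Sym2.eq_swap]; exact pRel_lab _ _ h
    have h3 := (Finset.card_le_card h2).trans Finset.card_image_le
    rw [Finset.card_filter] at h3
    have h4 : Fintype.card (PV n) = 2 * (n * 6 + 1) := by simp [PV]
    rw [h4] at h1
    simp only [ind]
    omega
  rw [Fintype.sum_option, Fintype.sum_prod_type] at hcard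
  have hloc : ∀ b i, (∑ t, ind (some ((b, i), t))) ≤ 6 ∧ (6 ≤ (∑ t, ind (some ((b, i), t))) →
      T.Adj (b, some (i, 0)) (ent b i 1) ∧ T.Adj (b, some (i, 4)) (ent b i 5) ∧
      T.Adj (b, some (i, 2)) (b, some (i, 3)) ∧
      ((T.Adj (b, some (i, 1)) (b, some (i, 3)) ∧
      T.Adj (b, some (i, 0)) (b, some (i, 2)) ∧ T.Adj (b, some (i, 4)) (b, some (i, 5))) ∨
      (¬ T.Adj (b, some (i, 1)) (b, some (i, 3)) ∧ T.Adj (b, some (i, 0)) (b, some (i, 1)) ∧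
      T.Adj (b, some (i, 2)) (b, some (i, 4)) ∧ T.Adj (b, some (i, 3)) (b, some (i, 5))))) := by
    intro b i
    have e1 := no_bad a B T hT b i 1 0 2 (by decide)
    have e2 := no_bad a B T hT b i 0 1 3 (by decide)
    have e3 := no_bad a B T hT b i 1 3 5 (by decide)
    have e4 := no_bad a B T hT b i 3 5 4 (by decide)
    have e5 := no_bad a B T hT b i 5 4 2 (by decide)
    have e6 := no_bad a B T hT b i 4 2 0 (by decide)
    rw [T.adj_comm (b, some (i, 1)) (b, some (i, 0))] at e1
    rw [T.adj_comm (b, some (i, 5)) (b, some (i, 4))] at e4 e5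
    rw [T.adj_comm (b, some (i, 4)) (b, some (i, 2)), T.adj_comm (b, some (i, 2)) (b, some (i, 0))] at e6
    rw [T.adj_comm (b, some (i, 4)) (b, some (i, 2))] at e5
    simp only [ind, Fin.sum_univ_succ, Fin.sum_univ_zero]
    change ((if T.Adj (b, some (i, 0)) (b, some (i, 1)) then 1 else 0) +
      ((if T.Adj (b, some (i, 2)) (b, some (i, 3)) then 1 else 0) +
      ((if T.Adj (b, some (i, 4)) (b, some (i, 5)) then 1 else 0) +
      ((if T.Adj (b, some (i, 0)) (b, some (i, 2)) then 1 else 0) +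
      ((if T.Adj (b, some (i, 1)) (b, some (i, 3)) then 1 else 0) +
      ((if T.Adj (b, some (i, 2)) (b, some (i, 4)) then 1 else 0) +
      ((if T.Adj (b, some (i, 3)) (b, some (i, 5)) then 1 else 0) +
      ((if T.Adj (b, some (i, 0)) (ent b i 1) then 1 else 0) +
      ((if T.Adj (b, some (i, 4)) (ent b i 5) then 1 else 0) + 0))))))))) ≤ 6 ∧
      (6 ≤ ((if T.Adj (b, some (i, 0)) (b, some (i, 1)) then 1 else 0) +
      ((if T.Adj (b, some (i, 2)) (b, some (i, 3)) then 1 else 0) +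
      ((if T.Adj (b, some (i, 4)) (b, some (i, 5)) then 1 else 0) +
      ((if T.Adj (b, some (i, 0)) (b, some (i, 2)) then 1 else 0) +
      ((if T.Adj (b, some (i, 1)) (b, some (i, 3)) then 1 else 0) +
      ((if T.Adj (b, some (i, 2)) (b, some (i, 4)) then 1 else 0) +
      ((if T.Adj (b, some (i, 3)) (b, some (i, 5)) then 1 else 0) +
      ((if T.Adj (b, some (i, 0)) (ent b i 1) then 1 else 0) +
      ((if T.Adj (b, some (i, 4)) (ent b i 5) then 1 else 0) + 0))))))))) → _)
    revert e1 e2 e3 e4 e5 e6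
    generalize T.Adj (b, some (i, 0)) (b, some (i, 1)) = A0
    generalize T.Adj (b, some (i, 2)) (b, some (i, 3)) = A1
    generalize T.Adj (b, some (i, 4)) (b, some (i, 5)) = A2
    generalize T.Adj (b, some (i, 0)) (b, some (i, 2)) = A3
    generalize T.Adj (b, some (i, 1)) (b, some (i, 3)) = A4
    generalize T.Adj (b, some (i, 2)) (b, some (i, 4)) = A5
    generalize T.Adj (b, some (i, 3)) (b, some (i, 5)) = A6
    generalize T.Adj (b, some (i, 0)) (ent b i 1) = A7
    generalize T.Adj (b, some (i, 4)) (ent b i 5) = A8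
    clear * -
    intro e1 e2 e3 e4 e5 e6
    refine ⟨?_, fun h => ?_⟩
    · grind (splits := 20)
    · refine ⟨?_, ?_, ?_, ?_⟩ <;> grind (splits := 20)
  have hnone : ind none = 1 ∧ ∀ x : Bool × Fin n, 6 ≤ ∑ t, ind (some (x, t)) := by
    have hle6 : ∀ x ∈ (Finset.univ : Finset (Bool × Fin n)), ∑ t, ind (some (x, t)) ≤ 6 :=
      fun x _ => (hloc x.1 x.2).1
    have hs : ∑ _x : Bool × Fin n, 6 = 12 * n := by simp; ring
    have h1 := Finset.sum_le_sum hle6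
    rw [hs] at h1
    have h2 := hind none
    refine ⟨by omega, fun x => ?_⟩
    by_contra hx
    have h3 := Finset.sum_lt_sum hle6 ⟨x, Finset.mem_univ _, by omega⟩
    rw [hs] at h3
    omega
  have hall := fun b i => (hloc b i).2 (hnone.2 (b, i))
  refine ⟨fun b => Finset.univ.filter (fun i => T.Adj (b, some (i, 1)) (b, some (i, 3))), ?_⟩
  apply ParG_le
  · have := hnone.1
    simp only [ind] at this
    by_contra hc
    rw [if_neg (by exact hc)] at this
    omega
  · exact fun b i => (hall b i).1
  · exact fun b i => (hall b i).2.1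
  · exact fun b i => (hall b i).2.2.1.symm
  · intro b i hi
    simp only [Finset.mem_filter, Finset.mem_univ, true_and] at hi
    rcases (hall b i).2.2.2 with h | h
    · exact ⟨h.1, h.2.1.symm, h.2.2.symm⟩
    · exact absurd hi h.1
  · intro b i hi
    simp only [Finset.mem_filter, Finset.mem_univ, true_and] at hi
    rcases (hall b i).2.2.2 with h | h
    · exact absurd h.1 hi
    · exact ⟨h.2.1.symm, h.2.2.1, h.2.2.2.symm⟩

theorem leaf_ne (S : Bool → Finset (Fin n)) (b : Bool) (l : Fin n) (hl : l.val + 1 = n) (o : Fin 6)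
    (ho : o = 1 ∨ o = 5) (v : PV n) : par S v ≠ (b, some (l, o)) := by
  have hent : ∀ c i o', ent c i o' ≠ ((b, some (l, o)) : PV n) := by
    intro c i o'
    unfold ent
    split_ifs
    · simp
    · intro h
      simp only [Prod.mk.injEq, Option.some.injEq, Fin.ext_iff] at h
      have := i.2
      omega
  obtain ⟨c, _ | ⟨i, t⟩⟩ := v
  · simp [par]
  · rcases fin6 t with rfl | rfl | rfl | rfl | rfl | rfl <;> simp only [par]
    · exact hent _ _ _
    · rcases ho with rfl | rfl <;> split_ifs <;> simp
    · rcases ho with rfl | rfl <;> split_ifs <;> simp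
    · rcases ho with rfl | rfl <;> simp
    · exact hent _ _ _
    · rcases ho with rfl | rfl <;> split_ifs <;> simp

def sg (b : Bool) : ℤ := if b then 1 else -1

theorem ends (a : Fin n → ℕ) (B : ℕ) (T : SimpleGraph (PV n))
    (hT : ∀ (u v : PV n) (p : T.Walk u v), p.IsPath → walkCost id (pCost n a B) p ≤ B)
    (S : Bool → Finset (Fin n)) (hS : ParG (par S) (false, none) ≤ T)
    (l : Fin n) (hl : l.val + 1 = n) (o o' : Fin 6) (ho : o = 1 ∨ o = 5) (ho' : o' = 1 ∨ o' = 5) :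
    CC a S (false, some (l, o)) + CC a S (true, some (l, o')) ≤ B := by
  classical
  have hc : (ParG (par S) (false, none)).Connected := ParG_conn rk (rk_par S)
  obtain ⟨p, hp⟩ := hc.exists_isPath (false, some (l, o)) (true, some (l, o'))
  have h1 := hT _ _ (p.mapLe hS) (hp.mapLe hS)
  have h2 : walkCost id (pCost n a B) (p.mapLe hS) = walkCost id (pCost n a B) p := by
    simp [walkCost]
  rw [h2] at h1
  cases p with
  | cons h q =>
    obtain ⟨v, hv⟩ := ParG_edgeOf h
    have hv2 : v = (false, some (l, o)) := by
      obtain ⟨hv, ⟨h3, h4⟩ | ⟨h3, h4⟩⟩ := hv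
      · exact h3.symm
      · exact absurd h4.symm (leaf_ne S _ l hl o ho v)
    subst hv2
    have := lower_bound (par := par S) (root := (false, none)) (pCost n a B) (pCost_symm a B)
      (fun v => sg v.1 * CC a S v) ?_ ?_ (fun v _ => leaf_ne S _ l hl o' ho' v) q _ _ h hv
    · simp only [sg] at this
      simp at this
      omega
    · intro v hv hv'
      have h3 := F3 a B S v hv hv'
      have h4 : (sg v.1 * CC a S v - sg (par S v).1 * CC a S (par S v) : ℤ) =
          sg v.1 * (CC a S v - CC a S (par S v)) := by
        have : (par S v).1 = v.1 := by
          obtain ⟨b, _ | ⟨i, t⟩⟩ := v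
          · exact absurd rfl hv'
          · rcases fin6 t with rfl | rfl | rfl | rfl | rfl | rfl <;> simp only [par, ent] <;>
            (try split_ifs) <;> rfl
        rw [this]; ring
      rw [h4, abs_mul, ← h3]
      have h5 : |sg v.1| = 1 := by unfold sg; split_ifs <;> simp
      rw [h5]
      push_cast
      simp
    · intro v w hv hw h
      rcases F4 a B S v w hv hw h with rfl | ⟨h3, h4, _⟩
      · rfl
      · simp [h3, h4]

end concrete

/-- Let `a_1, …, a_n` be positive integers and `B = Σ_i a_i`. Then the graph `G` (with
its reload costs) has a spanning tree of reload diameter at most `B` if and only if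
there is a set `S₁ ⊆ {1, …, n}` with `2 · Σ_{i ∈ S₁} a_i = B`. -/
theorem stmt8 (n : ℕ) (a : Fin n → ℕ) (ha : ∀ i, 0 < a i) (B : ℕ)
    (hB : B = ∑ i, a i) :
    (∃ T : SimpleGraph (PV n), T ≤ PG n ∧ T.IsTree ∧
      ∀ (u v : PV n) (p : T.Walk u v), p.IsPath →
        walkCost id (pCost n a B) p ≤ B) ↔
    (∃ S : Finset (Fin n), 2 * (∑ i ∈ S, a i) = B) := by
  constructor
  · rintro ⟨T, hle, htree, hT⟩
    obtain ⟨S, hS⟩ := structure_T a B T hle htree hT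
    rcases Nat.eq_zero_or_pos n with rfl | hn
    · exact ⟨∅, by simp [hB]⟩
    · let l : Fin n := ⟨n - 1, by omega⟩
      have hl : l.val + 1 = n := by simp only [l]; omega
      have key := ends a B T hT S hS l hl
      have h1 : ∀ b, CC a S (b, some (l, 1)) = ∑ i ∈ S b, a i := by
        intro b
        simp only [CC]
        rw [hl, pref_full]
      have h5 : ∀ b, CC a S (b, some (l, 5)) = ∑ i ∈ (S b)ᶜ, a i := by
        intro b
        simp only [CC]
        rw [hl, pref_full]
      have k1 := key 1 1 (Or.inl rfl) (Or.inl rfl)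
      have k2 := key 1 5 (Or.inl rfl) (Or.inr rfl)
      have k3 := key 5 1 (Or.inr rfl) (Or.inl rfl)
      have k4 := key 5 5 (Or.inr rfl) (Or.inr rfl)
      rw [h1, h1] at k1
      rw [h1, h5] at k2
      rw [h5, h1] at k3
      rw [h5, h5] at k4
      have s1 := Finset.sum_add_sum_compl (S false) a
      have s2 := Finset.sum_add_sum_compl (S true) a
      exact ⟨S false, by omega⟩
  · rintro ⟨S, hS⟩
    refine ⟨ParG (par fun _ => S) (false, none), ParG_le_PG _, ParG_tree rk (rk_par _), ?_⟩
    intro u v p hp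
    have s1 := Finset.sum_add_sum_compl S a
    have hC := fun w => CC_le a (fun _ => S) w (∑ i ∈ S, a i) (fun _ => le_rfl) (fun _ => by omega)
    have h := (upper_bound (pCost n a B) (pCost_symm a B) (CC a fun _ => S) ?_ ?_ ?_ p hp).1
    · have := hC u
      have := hC v
      omega
    · intro v hv
      by_cases hv' : par (fun _ => S) v = (false, none)
      · rw [hv']; simp [CC]
      · have := F3 a B _ v hv hv'
        omega
    · intro v hv hv'
      exact (F3 a B _ v hv hv').le
    · intro v w hv hw hne h
      rcases F4 a B _ v w hv hw h with h | h
      · exact absurd h hne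
      · exact h.2.2
end

section
/- Let G be a finite connected graph and let C be a cycle in G such that, for every edge e of C, the only cycle of G containing e is C. Then every spanning tree T of G contains all edges of C except exactly one; that is, |E(C) \ E(T)| = 1. -/
/-- Let `G` be a finite connected graph and let `C` be a cycle of `G` (given as a
closed walk `p` that is a cycle) such that, for every edge `e` of `C`, every cycle of
`G` containing `e` has the same edge set as `C`. Then every spanning tree `T` of `G`
omits exactly one edge of `C`. -/
theorem stmt14 {V : Type*} [Fintype V] (G : SimpleGraph V) (hconn : G.Connected)
    (v : V) (p : G.Walk v v) (hp : p.IsCycle)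
    (huniq : ∀ e ∈ p.edges, ∀ (w : V) (q : G.Walk w w), q.IsCycle → e ∈ q.edges →
      ∀ e' : Sym2 V, e' ∈ q.edges ↔ e' ∈ p.edges) :
    ∀ T : SimpleGraph V, T ≤ G → T.IsTree →
      {e : Sym2 V | e ∈ p.edges ∧ e ∉ T.edgeSet}.ncard = 1 := by
  intro T hT hTree
  have hex : ∃ e ∈ p.edges, e ∉ T.edgeSet := by
    by_contra hcon
    push Not at hcon
    exact hTree.IsAcyclic (p.transfer T hcon) (hp.transfer hcon)
  obtain ⟨e, hep, heT⟩ := hex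
  rw [Set.ncard_eq_one]
  refine ⟨e, ?_⟩
  ext e'
  simp only [Set.mem_setOf_eq, Set.mem_singleton_iff]
  refine ⟨?_, fun h => h ▸ ⟨hep, heT⟩⟩
  rintro ⟨he'p, he'T⟩
  have heG : e ∈ G.edgeSet := p.edges_subset_edgeSet hep
  induction e using Sym2.ind with
  | _ a b =>
  have hab : G.Adj a b := heG
  obtain ⟨q, hq⟩ := (hTree.connected.preconnected b a).exists_isPath
  have hqe : ∀ x, x ∈ (q.mapLe hT).edges → x ∈ T.edgeSet := by
    intro x hx
    rw [SimpleGraph.Walk.edges_mapLe_eq_edges] at hx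
    exact q.edges_subset_edgeSet hx
  have hc : (SimpleGraph.Walk.cons hab (q.mapLe hT)).IsCycle := by
    rw [SimpleGraph.Walk.cons_isCycle_iff]
    exact ⟨hq.mapLe hT, fun h => heT (hqe _ h)⟩
  have h := (huniq _ hep _ _ hc (by simp) e').2 he'p
  rw [SimpleGraph.Walk.edges_cons, List.mem_cons] at h
  exact h.resolve_right fun h => he'T (hqe _ h)
end
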